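/- Let n be even, 0 ≤ c < 3/2, and k = cn. For G ∈ {1,...,n}^k define Y_n(G) = n^k · ( Σ_σ P_n(G|σ) ) / C(n, n/2), where the sum is over all labelings σ ∈ {+,−}^n with exactly n/2 '+' labels and P_n(G|σ) = n^{−k}·Π_{i=1}^{k−1}( (3/2)·𝟙{σ_{G_i} = σ_{G_{i+1}}} + (1/2)·𝟙{σ_{G_i} ≠ σ_{G_{i+1}}} ). Then, for G drawn uniformly at random from {1,...,n}^k, E[Y_n²] ≤ √(2/(2 − 4c/3)) + o(1) as n → ∞. -/

import Mathlib

open Finset Filter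
open scoped Classical BigOperators

noncomputable section

/-- `P_n(G|σ) = n^{−k}·Π_{i=1}^{k−1} ((3/2)·𝟙{σ_{G_i} = σ_{G_{i+1}}} + (1/2)·𝟙{σ_{G_i} ≠ σ_{G_{i+1}}})`. -/
def Pcond (n k : ℕ) (σ : Fin n → Bool) (G : Fin k → Fin n) : ℝ :=
  ((n : ℝ) ^ k)⁻¹ *
    ∏ i : Fin k,
      if h : (i : ℕ) + 1 < k then
        (if σ (G i) = σ (G ⟨(i : ℕ) + 1, h⟩) then (3 : ℝ) / 2 else 1 / 2)
      else 1

/-- The likelihood ratio `Y_n(G) = n^k · (Σ_σ P_n(G|σ)) / C(n, n/2)`, the sum ranging over all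
labelings `σ ∈ {+,−}^n with exactly `n/2` '+' labels. -/
def Yn (n k : ℕ) (G : Fin k → Fin n) : ℝ :=
  (n : ℝ) ^ k *
    (∑ σ ∈ Finset.univ.filter
        (fun σ : Fin n → Bool => (Finset.univ.filter fun j => σ j = true).card = n / 2),
      Pcond n k σ G) / (n.choose (n / 2) : ℝ)

/-- The elementary bound `(1 - u) / (1 + u) ≤ exp (-2u)` on `[0, 1]`, without division. -/
lemma one_sub_mul_exp_two_mul_le {u : ℝ} (h0 : 0 ≤ u) (h1 : u ≤ 1) :
    (1 - u) * Real.exp (2 * u) ≤ 1 + u := by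
  rcases h1.lt_or_eq with h1 | rfl
  · have h := Real.sum_range_le_log_div h0 h1 1
    simp only [sum_range_one, mul_zero, zero_add, pow_one, Nat.cast_zero, div_one] at h
    have h3 : Real.exp (2 * u) ≤ (1 + u) / (1 - u) := by
      rw [← Real.le_log_iff_exp_le (div_pos (by linarith) (by linarith))]
      linarith
    rwa [le_div_iff₀ (by linarith), mul_comm] at h3
  · norm_num

lemma choose_succ_mul_exp_le {m j : ℕ} (hj : m ≤ 2 * j + 1) :
    (m.choose (j + 1) : ℝ) * Real.exp ((2 * (j + 1 : ℕ) - m : ℝ) ^ 2 / (2 * (m + 1))) ≤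
      m.choose j * Real.exp ((2 * j - m : ℝ) ^ 2 / (2 * (m + 1))) := by
  rcases lt_or_ge j m with hjm | hjm
  · have hm : (0 : ℝ) < m + 1 := by positivity
    have hj' : (m : ℝ) ≤ 2 * j + 1 := by exact_mod_cast hj
    have hjm' : (j : ℝ) + 1 ≤ m := by exact_mod_cast hjm
    set u : ℝ := (2 * j - m + 1) / (m + 1) with hu
    have hu0 : 0 ≤ u := div_nonneg (by linarith) hm.le
    have hu1 : u ≤ 1 := by rw [hu, div_le_one hm]; linarith
    have hrec : (m.choose (j + 1) : ℝ) * (j + 1) = m.choose j * (m - j) := by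
      have h := congrArg (Nat.cast (R := ℝ)) (Nat.choose_succ_right_eq m j)
      push_cast [hjm.le] at h
      exact h
    have e1 : (j : ℝ) + 1 = (m + 1) / 2 * (1 + u) := by rw [hu]; field_simp; ring
    have e2 : (m : ℝ) - j = (m + 1) / 2 * (1 - u) := by rw [hu]; field_simp; ring
    have hexp : (2 * (j + 1 : ℕ) - m : ℝ) ^ 2 / (2 * (m + 1)) =
        2 * u + (2 * j - m : ℝ) ^ 2 / (2 * (m + 1)) := by
      rw [hu]; push_cast; field_simp; ring
    have hrec' : (m.choose (j + 1) : ℝ) * (1 + u) = m.choose j * (1 - u) := by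
      rw [e1, e2] at hrec
      have : (0 : ℝ) < (m + 1) / 2 := by positivity
      apply mul_left_cancel₀ this.ne'
      linarith
    rw [hexp, Real.exp_add, ← mul_assoc]
    refine mul_le_mul_of_nonneg_right ?_ (Real.exp_pos _).le
    have h1u : 0 < 1 + u := by linarith
    refine le_of_mul_le_mul_right ?_ h1u
    calc (m.choose (j + 1) : ℝ) * Real.exp (2 * u) * (1 + u)
        = m.choose j * ((1 - u) * Real.exp (2 * u)) := by
          rw [mul_right_comm, hrec', mul_assoc]
      _ ≤ m.choose j * (1 + u) :=
          mul_le_mul_of_nonneg_left (one_sub_mul_exp_two_mul_le hu0 hu1) (by positivity)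
  · rw [Nat.choose_eq_zero_of_lt (by omega : m < j + 1)]
    simp only [Nat.cast_zero, zero_mul]
    positivity

/-- A Gaussian bound for binomial coefficients in terms of the central one. -/
lemma choose_mul_exp_le {m j : ℕ} (hj : j ≤ m) :
    (m.choose j : ℝ) * Real.exp ((2 * j - m : ℝ) ^ 2 / (2 * (m + 1))) ≤
      m.choose (m / 2) * Real.exp (1 / (2 * (m + 1))) := by
  wlog hjm : (m + 1) / 2 ≤ j generalizing j
  · have h := this (j := m - j) (by omega) (by omega)
    rw [Nat.choose_symm hj, Nat.cast_sub hj] at h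
    convert h using 4
    ring
  clear hj
  induction j, hjm using Nat.le_induction with
  | base =>
    have hs : m.choose ((m + 1) / 2) = m.choose (m / 2) := by
      rw [← Nat.choose_symm (by omega : (m + 1) / 2 ≤ m)]
      congr 1; omega
    rw [hs]
    gcongr
    rcases Nat.even_or_odd' m with ⟨h, rfl | rfl⟩
    · rw [show (2 * h + 1) / 2 = h by omega]; push_cast; norm_num
    · rw [show (2 * h + 1 + 1) / 2 = h + 1 by omega]; push_cast; ring_nf; norm_num
  | succ j hj ih => exact (choose_succ_mul_exp_le (by omega)).trans ih

lemma choose_sq_le {m j : ℕ} (hj : j ≤ m) :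
    (m.choose j : ℝ) ^ 2 ≤ (m.choose (m / 2) : ℝ) ^ 2 * Real.exp (1 / (m + 1)) *
      Real.exp (-((2 * j - m : ℝ) ^ 2 / (m + 1))) := by
  have h := pow_le_pow_left₀ (by positivity) (choose_mul_exp_le hj) 2
  rw [mul_pow, mul_pow, ← Real.exp_nat_mul, ← Real.exp_nat_mul] at h
  have e1 : ((2 : ℕ) : ℝ) * ((2 * j - m : ℝ) ^ 2 / (2 * (m + 1))) =
    (2 * j - m : ℝ) ^ 2 / (m + 1) := by push_cast; field_simp
  have e2 : ((2 : ℕ) : ℝ) * (1 / (2 * (m + 1 : ℝ))) = 1 / (m + 1) := by push_cast; field_simp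
  rw [e1, e2] at h
  rwa [Real.exp_neg, ← div_eq_mul_inv, le_div_iff₀ (Real.exp_pos _)]

lemma sum_exp_neg_sq_le {b x₀ : ℝ} (hb : 0 < b) (hx : 0 ≤ x₀) (N : ℕ) :
    ∑ i ∈ range N, Real.exp (-b * (x₀ + i) ^ 2) ≤ 1 + √(Real.pi / b) / 2 := by
  have hanti : AntitoneOn (fun x : ℝ => Real.exp (-b * x ^ 2)) (Set.Ici 0) := by
    intro x hx y _ hxy
    have : x ^ 2 ≤ y ^ 2 := pow_le_pow_left₀ hx hxy 2
    simp only [Real.exp_le_exp]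
    nlinarith
  cases N with
  | zero => simp only [range_zero, sum_empty]; positivity
  | succ N =>
    rw [sum_range_succ', add_comm]
    refine add_le_add (Real.exp_le_one_iff.2 (by nlinarith [sq_nonneg (x₀ + (0 : ℕ))])) ?_
    have h := AntitoneOn.sum_le_integral (x₀ := x₀) (a := N)
      (hanti.mono fun x hx' => hx.trans hx'.1)
    refine h.trans ?_
    rw [intervalIntegral.integral_of_le (by simp), ← integral_gaussian_Ioi b]
    refine MeasureTheory.setIntegral_mono_set (integrable_exp_neg_mul_sq hb).integrableOn
      (Eventually.of_forall fun x => (Real.exp_pos _).le)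
      (Eventually.of_forall fun x hx' => lt_of_le_of_lt hx hx'.1)

lemma sum_exp_neg_two_mul_sub_sq_le {b : ℝ} (hb : 0 < b) (m : ℕ) :
    ∑ j ∈ range (m + 1), Real.exp (-b * (2 * j - m) ^ 2) ≤ 2 + √(Real.pi / b) / 2 := by
  obtain ⟨H, hH⟩ : ∃ H, H = (m + 1) / 2 := ⟨_, rfl⟩
  have hle : (m : ℝ) ≤ 2 * H := by exact_mod_cast (by omega : m ≤ 2 * H)
  have hle' : (2 * H : ℝ) ≤ m + 1 := by exact_mod_cast (by omega : 2 * H ≤ m + 1)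
  have hb4 : 0 < 4 * b := by linarith
  have hsqrt : √(Real.pi / (4 * b)) = √(Real.pi / b) / 2 := by
    rw [show Real.pi / (4 * b) = Real.pi / b / 2 ^ 2 by field_simp; norm_num,
      Real.sqrt_div' _ (by positivity), Real.sqrt_sq (by norm_num)]
  have h1 := sum_exp_neg_sq_le hb4 (show 0 ≤ (m : ℝ) / 2 - H + 1 by linarith) H
  have h2 := sum_exp_neg_sq_le hb4 (show 0 ≤ (H : ℝ) - m / 2 by linarith) (m + 1 - H)
  rw [show m + 1 = H + (m + 1 - H) by omega, sum_range_add, ← sum_range_reflect]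
  rw [hsqrt] at h1 h2
  have e1 : ∑ j ∈ range H, Real.exp (-b * (2 * ((H - 1 - j : ℕ) : ℝ) - m) ^ 2) =
      ∑ i ∈ range H, Real.exp (-(4 * b) * ((m : ℝ) / 2 - H + 1 + i) ^ 2) := by
    refine sum_congr rfl fun j hj => ?_
    have := mem_range.1 hj
    rw [Nat.sub_sub, Nat.cast_sub (by omega)]
    push_cast
    ring_nf
  have e2 : ∑ j ∈ range (m + 1 - H), Real.exp (-b * (2 * ((H + j : ℕ) : ℝ) - m) ^ 2) =
      ∑ i ∈ range (m + 1 - H), Real.exp (-(4 * b) * ((H : ℝ) - m / 2 + i) ^ 2) := by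
    refine sum_congr rfl fun j _ => ?_
    push_cast
    ring_nf
  rw [e1, e2]
  linarith

lemma tendsto_centralBinom_mul_sqrt_div :
    Tendsto (fun h : ℕ => (h.centralBinom : ℝ) * √h / 4 ^ h) atTop (nhds (1 / √Real.pi)) := by
  have h1 := Stirling.tendsto_stirlingSeq_sqrt_pi
  have h2 : Tendsto (fun h : ℕ => Stirling.stirlingSeq (2 * h) / Stirling.stirlingSeq h ^ 2) atTop
      (nhds (√Real.pi / √Real.pi ^ 2)) :=
    (h1.comp (tendsto_id.const_mul_atTop' two_pos)).div (h1.pow 2) (by positivity)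
  have e : √Real.pi / √Real.pi ^ 2 = 1 / √Real.pi := by
    have : √Real.pi ≠ 0 := by positivity
    field_simp
  rw [e] at h2
  refine h2.congr' ?_
  filter_upwards [eventually_gt_atTop 0] with h hh
  have hh' : (0 : ℝ) < h := by exact_mod_cast hh
  have hcb : (h.centralBinom : ℝ) * ((h.factorial : ℝ) * h.factorial) = (2 * h).factorial := by
    have := Nat.choose_mul_factorial_mul_factorial (show h ≤ 2 * h by omega)
    rw [show 2 * h - h = h by omega] at this
    rw [Nat.centralBinom, ← this]; push_cast; ring
  simp only [Stirling.stirlingSeq]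
  rw [← hcb]
  push_cast
  have s1 : √(2 * (2 * (h : ℝ))) = 2 * √h := by
    rw [show 2 * (2 * (h : ℝ)) = 2 ^ 2 * h by ring, Real.sqrt_mul (by norm_num),
      Real.sqrt_sq (by norm_num)]
  have s2 : √(2 * (h : ℝ)) ^ 2 = 2 * h := Real.sq_sqrt (by positivity)
  have s3 : √(h : ℝ) ^ 2 = h := Real.sq_sqrt (by positivity)
  have s4 : (2 * (h : ℝ) / Real.exp 1) ^ (2 * h) = 4 ^ h * ((h / Real.exp 1) ^ h) ^ 2 := by
    rw [mul_div_assoc, mul_pow, pow_mul, pow_mul']; norm_num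
  have s5 : √(h : ℝ) ≠ 0 := by positivity
  have s6 : (h.factorial : ℝ) ≠ 0 := by positivity
  have s7 : ((h : ℝ) / Real.exp 1) ^ h ≠ 0 := by positivity
  rw [s1, s4]
  generalize ((h : ℝ) / Real.exp 1) ^ h = t at s7
  rw [div_pow, mul_pow √(2 * (h : ℝ)), s2]
  field_simp
  rw [s3]

lemma sum_choose_sq_mul_exp_le {α : ℝ} {m : ℕ} (hβ : 0 < 1 / (m + 1 : ℝ) - α / m) :
    ∑ j ∈ range (m + 1), (m.choose j : ℝ) ^ 2 * Real.exp (α * ((2 * j - m : ℝ) ^ 2 / m)) ≤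
      (m.choose (m / 2) : ℝ) ^ 2 * Real.exp (1 / (m + 1)) *
        (2 + √(Real.pi / (1 / (m + 1 : ℝ) - α / m)) / 2) := by
  refine le_trans ?_ (mul_le_mul_of_nonneg_left (sum_exp_neg_two_mul_sub_sq_le hβ m)
    (by positivity))
  rw [mul_sum]
  refine sum_le_sum fun j hj => ?_
  have h := choose_sq_le (show j ≤ m by have := mem_range.1 hj; omega)
  refine (mul_le_mul_of_nonneg_right h (Real.exp_pos _).le).trans_eq ?_
  rw [mul_assoc _ (Real.exp _) (Real.exp _), ← Real.exp_add]
  congr 2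
  ring

lemma choose_half_eq (m : ℕ) : (m.choose (m / 2) : ℝ) =
    ((m + 1) / 2).centralBinom * 2 ^ m / 4 ^ ((m + 1) / 2) := by
  rcases Nat.even_or_odd' m with ⟨h, rfl | rfl⟩
  · rw [show (2 * h + 1) / 2 = h by omega, show 2 * h / 2 = h by omega, Nat.centralBinom, pow_mul]
    norm_num
  · rw [show (2 * h + 1 + 1) / 2 = h + 1 by omega, show (2 * h + 1) / 2 = h by omega,
      Nat.centralBinom, show 2 * (h + 1) = 2 * h + 1 + 1 by ring, Nat.choose_succ_succ,
      Nat.choose_symm_half, pow_succ, pow_succ, pow_mul]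
    push_cast
    field_simp
    ring

lemma tendsto_choose_half_sq_div :
    Tendsto (fun m : ℕ => (m.choose (m / 2) : ℝ) ^ 2 / (2 * m).choose m * √m) atTop
      (nhds (2 / √Real.pi)) := by
  have hg := tendsto_centralBinom_mul_sqrt_div
  have hH : Tendsto (fun m : ℕ => (m + 1) / 2) atTop atTop :=
    tendsto_atTop.2 fun b => (eventually_ge_atTop (2 * b)).mono fun m hm => by omega
  have hdiv : Tendsto (fun m : ℕ => (m : ℝ) / ((m + 1) / 2 : ℕ)) atTop (nhds 2) := by
    have h1 : Tendsto (fun m : ℕ => 2 * ((m : ℝ) / (m + 1))) atTop (nhds 2) := by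
      simpa using (tendsto_natCast_div_add_atTop (1 : ℝ)).const_mul 2
    refine tendsto_of_tendsto_of_tendsto_of_le_of_le' h1 tendsto_const_nhds ?_ ?_
    · filter_upwards [eventually_gt_atTop 0] with m hm
      have h2 : (2 * ((m + 1) / 2 : ℕ) : ℝ) ≤ m + 1 := by
        exact_mod_cast (by omega : 2 * ((m + 1) / 2) ≤ m + 1)
      have h3 : (0 : ℝ) < ((m + 1) / 2 : ℕ) := by
        exact_mod_cast (by omega : 0 < (m + 1) / 2)
      rw [← mul_div_assoc, div_le_div_iff₀ (by positivity) h3]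
      nlinarith [show (0 : ℝ) ≤ m by positivity]
    · filter_upwards [eventually_gt_atTop 0] with m hm
      have h2 : (m : ℝ) ≤ 2 * ((m + 1) / 2 : ℕ) := by
        exact_mod_cast (by omega : m ≤ 2 * ((m + 1) / 2))
      have h3 : (0 : ℝ) < ((m + 1) / 2 : ℕ) := by
        exact_mod_cast (by omega : 0 < (m + 1) / 2)
      rwa [div_le_iff₀ h3]
  have h := (((hg.comp hH).pow 2).div hg (by positivity)).mul hdiv
  have e : (1 / √Real.pi) ^ 2 / (1 / √Real.pi) * 2 = 2 / √Real.pi := by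
    have : √Real.pi ≠ 0 := by positivity
    field_simp
  rw [e] at h
  refine h.congr' ?_
  filter_upwards [eventually_gt_atTop 0] with m hm
  have hm' : (0 : ℝ) < m := by exact_mod_cast hm
  have h3 : (0 : ℝ) < ((m + 1) / 2 : ℕ) := by exact_mod_cast (by omega : 0 < (m + 1) / 2)
  rw [choose_half_eq]
  simp only [Pi.div_apply, Function.comp_apply]
  rw [show (2 * m).choose m = m.centralBinom from rfl]
  have hc : (m.centralBinom : ℝ) ≠ 0 := by exact_mod_cast (Nat.centralBinom_pos m).ne'
  generalize (m + 1) / 2 = H at *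
  have s1 : √(m : ℝ) ^ 2 = m := Real.sq_sqrt hm'.le
  have s2 : √(H : ℝ) ^ 2 = H := Real.sq_sqrt h3.le
  have s3 : √(m : ℝ) ≠ 0 := by positivity
  have s4 : ((2 : ℝ) ^ m) ^ 2 = 4 ^ m := by rw [← pow_mul, mul_comm, pow_mul]; norm_num
  have s5 : (4 : ℝ) ^ m ≠ 0 := by positivity
  rw [div_pow, div_pow, mul_pow, mul_pow, s2, s4]
  generalize ((4 : ℝ) ^ H) ^ 2 = u
  generalize ((4 : ℝ) ^ m) = v at *
  nth_rw 2 [← s1]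
  field_simp

/-- An upper bound for the second moment when `n = 2 * m`, with `α = 2 * c / 3`. -/
def momentBound (α : ℝ) (m : ℕ) : ℝ :=
  (m.choose (m / 2) : ℝ) ^ 2 * Real.exp (1 / (m + 1)) *
    (2 + √(Real.pi / (1 / (m + 1 : ℝ) - α / m)) / 2) / (2 * m).choose m

lemma tendsto_scaled_rate (α : ℝ) :
    Tendsto (fun m : ℕ => (m : ℝ) * (1 / (m + 1 : ℝ) - α / m)) atTop (nhds (1 - α)) := by
  refine ((tendsto_natCast_div_add_atTop (1 : ℝ)).sub_const α).congr' ?_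
  filter_upwards [eventually_gt_atTop 0] with m hm
  have hm' : (m : ℝ) ≠ 0 := by exact_mod_cast hm.ne'
  field_simp

lemma tendsto_momentBound {α : ℝ} (hα : α < 1) :
    Tendsto (momentBound α) atTop (nhds √(1 / (1 - α))) := by
  have hs : 0 < 1 - α := by linarith
  have h1 : Tendsto (fun m : ℕ => 2 / √(m : ℝ) +
      √(Real.pi / ((m : ℝ) * (1 / (m + 1 : ℝ) - α / m))) / 2) atTop
      (nhds (0 + √(Real.pi / (1 - α)) / 2)) := by
    refine Tendsto.add ?_ (Tendsto.div_const (Tendsto.sqrt ?_) 2)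
    · exact (Real.tendsto_sqrt_atTop.comp tendsto_natCast_atTop_atTop).const_div_atTop 2
    · exact tendsto_const_nhds.div (tendsto_scaled_rate α) hs.ne'
  have h2 : Tendsto (fun m : ℕ => Real.exp (1 / (m + 1 : ℝ))) atTop (nhds 1) := by
    have := (Real.continuous_exp.tendsto 0).comp tendsto_one_div_add_atTop_nhds_zero_nat
    rwa [Real.exp_zero] at this
  have h := (tendsto_choose_half_sq_div.mul h2).mul h1
  have e : 2 / √Real.pi * 1 * (0 + √(Real.pi / (1 - α)) / 2) = √(1 / (1 - α)) := by
    have : √Real.pi ≠ 0 := by positivity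
    rw [Real.sqrt_div Real.pi_pos.le, Real.sqrt_div zero_le_one, Real.sqrt_one]
    field_simp
    ring
  rw [e] at h
  refine h.congr' ?_
  filter_upwards [eventually_gt_atTop 0] with m hm
  have hm' : (0 : ℝ) < m := by exact_mod_cast hm
  have s3 : √(m : ℝ) ≠ 0 := by positivity
  have e2 : √(Real.pi / ((m : ℝ) * (1 / (m + 1 : ℝ) - α / m))) =
      √(Real.pi / (1 / (m + 1 : ℝ) - α / m)) / √m := by
    rw [mul_comm, ← div_div, Real.sqrt_div' _ hm'.le]
  rw [e2, momentBound]
  generalize √(Real.pi / (1 / (m + 1 : ℝ) - α / m)) = t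
  field_simp

/-- The unnormalised likelihood of a sequence `G` given the labeling `σ`. -/
def pathWeight {n k : ℕ} (σ : Fin n → Bool) (G : Fin k → Fin n) : ℝ :=
  ∏ i : Fin k,
    if h : (i : ℕ) + 1 < k then
      (if σ (G i) = σ (G ⟨(i : ℕ) + 1, h⟩) then (3 : ℝ) / 2 else 1 / 2)
    else 1

/-- The `±1` spin of a label. -/
def spin (b : Bool) : ℝ := if b then 1 else -1

lemma pathWeight_cons {n k : ℕ} (σ : Fin n → Bool) (x : Fin n) (G : Fin (k + 1) → Fin n) :
    pathWeight σ (Fin.cons x G : Fin (k + 2) → Fin n) =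
      (1 + spin (σ x) * spin (σ (G 0)) / 2) * pathWeight σ G := by
  unfold pathWeight
  rw [Fin.prod_univ_succ]
  congr 1
  · have h0 : (⟨0 + 1, by omega⟩ : Fin (k + 2)) = Fin.succ 0 := rfl
    simp only [Fin.val_zero, Fin.cons_zero, h0, Fin.cons_succ]
    cases σ x <;> cases σ (G 0) <;> norm_num [spin]
  · refine prod_congr rfl fun i _ => ?_
    by_cases h : (i : ℕ) + 1 < k + 1
    · have hs : (⟨(i.succ : ℕ) + 1, by simpa using h⟩ : Fin (k + 2)) =
        Fin.succ ⟨(i : ℕ) + 1, h⟩ := rfl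
      rw [dif_pos h, dif_pos (by simpa using h), hs, Fin.cons_succ, Fin.cons_succ]
    · rw [dif_neg h, dif_neg (by simpa using h)]

/-- Coefficients `(a, b)` of the `k`-th iterate of the transfer operator of a pair of labelings
with normalised overlap `ρ`, applied to `1`, in the form `a + b * (product of spins)`. -/
def transferCoeff (ρ : ℝ) : ℕ → ℝ × ℝ
  | 0 => (1, 0)
  | k + 1 => ((transferCoeff ρ k).1 + ρ * (transferCoeff ρ k).2,
      (ρ * (transferCoeff ρ k).1 + (transferCoeff ρ k).2) / 4)

lemma transferCoeff_bounds (ρ : ℝ) (k : ℕ) :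
    0 ≤ (transferCoeff ρ k).1 ∧ 0 ≤ ρ * (transferCoeff ρ k).2 ∧
      (transferCoeff ρ k).1 + 4 / 3 * (ρ * (transferCoeff ρ k).2) ≤ (1 + ρ ^ 2 / 3) ^ k := by
  induction k with
  | zero => simp [transferCoeff]
  | succ k ih =>
    obtain ⟨h1, h2, h3⟩ := ih
    simp only [transferCoeff]
    generalize (transferCoeff ρ k).1 = a at *
    generalize (transferCoeff ρ k).2 = b at *
    have hρ := sq_nonneg ρ
    refine ⟨by linarith, ?_, ?_⟩
    · nlinarith [mul_nonneg hρ h1]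
    · rw [pow_succ]
      have := mul_le_mul_of_nonneg_right h3 (show 0 ≤ 1 + ρ ^ 2 / 3 by positivity)
      nlinarith [mul_nonneg hρ h2]

lemma transferCoeff_fst_le (ρ : ℝ) (k : ℕ) :
    (transferCoeff ρ k).1 ≤ Real.exp (k * (ρ ^ 2 / 3)) := by
  obtain ⟨-, h2, h3⟩ := transferCoeff_bounds ρ k
  rw [Real.exp_nat_mul]
  refine le_trans (by linarith) (h3.trans (pow_le_pow_left₀ (by positivity) ?_ k))
  linarith [Real.add_one_le_exp (ρ ^ 2 / 3)]

lemma sum_fin_succ_fun {n k : ℕ} (f : (Fin (k + 1) → Fin n) → ℝ) :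
    ∑ G, f G = ∑ x, ∑ G : Fin k → Fin n, f (Fin.cons x G : Fin (k + 1) → Fin n) := by
  rw [← (Fin.consEquiv fun _ => Fin n).sum_comp, Fintype.sum_prod_type]
  rfl

lemma spin_mul_self (b : Bool) : spin b * spin b = 1 := by cases b <;> norm_num [spin]

section TransferOperator

variable {n : ℕ} {σ τ : Fin n → Bool} {ρ : ℝ}

lemma sum_pathWeight_cons_mul (hσ : ∑ i, spin (σ i) = 0) (hτ : ∑ i, spin (τ i) = 0)
    (hρ : ∑ i, spin (σ i) * spin (τ i) = n * ρ) (k : ℕ) (x : Fin n) :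
    ∑ G : Fin k → Fin n, pathWeight σ (Fin.cons x G : Fin (k + 1) → Fin n) *
        pathWeight τ (Fin.cons x G : Fin (k + 1) → Fin n) =
      n ^ k * ((transferCoeff ρ k).1 + (transferCoeff ρ k).2 * (spin (σ x) * spin (τ x))) := by
  induction k generalizing x with
  | zero => simp [pathWeight, transferCoeff]
  | succ k ih =>
    rw [sum_fin_succ_fun]
    simp only [pathWeight_cons, Fin.cons_zero]
    have key : ∀ y : Fin n, ∑ G : Fin k → Fin n,
        (1 + spin (σ x) * spin (σ y) / 2) *
            pathWeight σ (Fin.cons y G : Fin (k + 1) → Fin n) *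
          ((1 + spin (τ x) * spin (τ y) / 2) *
            pathWeight τ (Fin.cons y G : Fin (k + 1) → Fin n)) =
        n ^ k * (((transferCoeff ρ k).1 + (transferCoeff ρ k).2 * (spin (σ x) * spin (τ x)) / 4) +
          ((transferCoeff ρ k).1 * spin (σ x) / 2 + (transferCoeff ρ k).2 * spin (τ x) / 2)
              * spin (σ y) +
          ((transferCoeff ρ k).1 * spin (τ x) / 2 + (transferCoeff ρ k).2 * spin (σ x) / 2)
              * spin (τ y) +
          ((transferCoeff ρ k).2 + (transferCoeff ρ k).1 * (spin (σ x) * spin (τ x)) / 4) *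
            (spin (σ y) * spin (τ y))) := by
      intro y
      have e : ∀ G : Fin k → Fin n, (1 + spin (σ x) * spin (σ y) / 2) *
            pathWeight σ (Fin.cons y G : Fin (k + 1) → Fin n) *
          ((1 + spin (τ x) * spin (τ y) / 2) *
            pathWeight τ (Fin.cons y G : Fin (k + 1) → Fin n)) =
          ((1 + spin (σ x) * spin (σ y) / 2) * (1 + spin (τ x) * spin (τ y) / 2)) *
          (pathWeight σ (Fin.cons y G : Fin (k + 1) → Fin n) *
            pathWeight τ (Fin.cons y G : Fin (k + 1) → Fin n)) := fun G => by ring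
      simp only [e]
      rw [← mul_sum, ih y]
      have h1 := spin_mul_self (σ y)
      have h2 := spin_mul_self (τ y)
      generalize spin (σ y) = s at *
      generalize spin (τ y) = t at *
      generalize (transferCoeff ρ k).1 = a
      generalize (transferCoeff ρ k).2 = b
      generalize spin (σ x) = u
      generalize spin (τ x) = v
      linear_combination (n : ℝ) ^ k * b * (u * t / 2 + u * v * t * t / 4) * h1 +
        (n : ℝ) ^ k * b * (v * s / 2 + u * v / 4) * h2
    simp only [key]
    rw [← mul_sum, sum_add_distrib, sum_add_distrib, sum_add_distrib, ← mul_sum, ← mul_sum,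
      ← mul_sum, hσ, hτ, hρ, sum_const, card_univ, Fintype.card_fin, nsmul_eq_mul]
    simp only [transferCoeff]
    ring

lemma sum_pathWeight_mul (hσ : ∑ i, spin (σ i) = 0) (hτ : ∑ i, spin (τ i) = 0)
    (hρ : ∑ i, spin (σ i) * spin (τ i) = n * ρ) (k : ℕ) :
    ∑ G : Fin k → Fin n, pathWeight σ G * pathWeight τ G = n ^ k * (transferCoeff ρ k).1 := by
  cases k with
  | zero => simp [pathWeight, transferCoeff]
  | succ k =>
    rw [sum_fin_succ_fun]
    simp only [sum_pathWeight_cons_mul hσ hτ hρ]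
    rw [← mul_sum, sum_add_distrib, ← mul_sum, hρ, sum_const, card_univ, Fintype.card_fin,
      nsmul_eq_mul]
    simp only [transferCoeff]
    ring

end TransferOperator

/-- Labelings of `Fin n` with exactly `m` labels `true`. -/
def labelings (n m : ℕ) : Finset (Fin n → Bool) :=
  univ.filter fun σ => (univ.filter fun j => σ j = true).card = m

/-- The number of common `true` labels. -/
def overlap {n : ℕ} (σ τ : Fin n → Bool) : ℕ :=
  (univ.filter fun j => σ j = true ∧ τ j = true).card

lemma sum_ite_eq_card {n : ℕ} (p : Fin n → Prop) [DecidablePred p] :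
    ∑ i, (if p i then (1 : ℝ) else 0) = (univ.filter p).card := by simp

lemma sum_spin {m : ℕ} {σ : Fin (2 * m) → Bool} (hσ : σ ∈ labelings (2 * m) m) :
    ∑ i, spin (σ i) = 0 := by
  have h := (mem_filter.1 hσ).2
  have e : ∀ i, spin (σ i) = 2 * (if σ i = true then (1 : ℝ) else 0) - 1 := fun i => by
    cases σ i <;> norm_num [spin]
  simp only [e]
  rw [sum_sub_distrib, ← mul_sum, sum_ite_eq_card, h]
  simp

lemma sum_spin_mul {m : ℕ} (hm : 0 < m) {σ τ : Fin (2 * m) → Bool}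
    (hσ : σ ∈ labelings (2 * m) m) (hτ : τ ∈ labelings (2 * m) m) :
    ∑ i, spin (σ i) * spin (τ i) = (2 * m : ℕ) * ((2 * overlap σ τ - m) / m) := by
  have e : ∀ i, spin (σ i) * spin (τ i) =
      4 * (if σ i = true ∧ τ i = true then (1 : ℝ) else 0) - spin (σ i) - spin (τ i) - 1 :=
    fun i => by cases σ i <;> cases τ i <;> norm_num [spin]
  simp only [e]
  rw [sum_sub_distrib, sum_sub_distrib, sum_sub_distrib, sum_spin hσ, sum_spin hτ, ← mul_sum,
    sum_ite_eq_card]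
  have hm' : (m : ℝ) ≠ 0 := by exact_mod_cast hm.ne'
  simp only [overlap, sum_const, card_univ, Fintype.card_fin, nsmul_eq_mul]
  push_cast
  field_simp
  ring

lemma card_labelings_le (n m : ℕ) : (labelings n m).card ≤ n.choose m := by
  have h : (powersetCard m (univ : Finset (Fin n))).card = n.choose m := by simp
  rw [← h]
  refine card_le_card_of_injOn (fun σ => univ.filter fun j => σ j = true) ?_ ?_
  · intro σ hσ
    have := (mem_filter.1 hσ).2
    simp [mem_powersetCard, this]
  · intro σ _ τ _ hστ
    funext i
    have := Finset.ext_iff.1 hστ i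
    simp only [mem_filter, mem_univ, true_and] at this
    exact Bool.eq_iff_iff.2 this

lemma overlap_le {n m : ℕ} (σ : Fin n → Bool) {τ : Fin n → Bool} (hτ : τ ∈ labelings n m) :
    overlap σ τ ≤ m := by
  rw [← (mem_filter.1 hτ).2]
  exact card_le_card fun i hi => by simp_all

lemma card_overlap_eq_le {m : ℕ} {σ : Fin (2 * m) → Bool} (hσ : σ ∈ labelings (2 * m) m)
    {j : ℕ} (hj : j ≤ m) :
    ((labelings (2 * m) m).filter fun τ => overlap σ τ = j).card ≤ m.choose j ^ 2 := by
  have hS := (mem_filter.1 hσ).2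
  obtain ⟨S, hSdef⟩ : ∃ S : Finset (Fin (2 * m)), S = univ.filter fun i => σ i = true := ⟨_, rfl⟩
  rw [← hSdef] at hS
  have hSc : Sᶜ.card = m := by rw [card_compl, hS, Fintype.card_fin]; omega
  have h : (powersetCard j S ×ˢ powersetCard (m - j) Sᶜ).card = m.choose j ^ 2 := by
    rw [card_product, card_powersetCard, card_powersetCard, hS, hSc, Nat.choose_symm hj, sq]
  rw [← h]
  have hinter : ∀ τ : Fin (2 * m) → Bool,
      (S ∩ univ.filter fun i => τ i = true).card = overlap σ τ := fun τ => by
    rw [overlap, hSdef, filter_and]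
  refine card_le_card_of_injOn (fun τ => (S ∩ univ.filter fun i => τ i = true,
    (univ.filter fun i => τ i = true) \ S)) ?_ ?_
  · intro τ hτ
    obtain ⟨hτ1, hτ2⟩ := mem_filter.1 hτ
    have hT := (mem_filter.1 hτ1).2
    have h1 := card_sdiff_add_card_inter (univ.filter fun i => τ i = true) S
    rw [inter_comm, hinter, hτ2, hT] at h1
    simp only [coe_product, Set.mem_prod, mem_coe, mem_powersetCard]
    refine ⟨⟨inter_subset_left, by rw [hinter, hτ2]⟩, fun i hi => ?_, by omega⟩
    exact mem_compl.2 (Finset.mem_sdiff.1 hi).2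
  · intro τ _ τ' _ hττ
    simp only [Prod.mk.injEq] at hττ
    funext i
    have h1 := Finset.ext_iff.1 hττ.1 i
    have h2 := Finset.ext_iff.1 hττ.2 i
    simp only [mem_inter, Finset.mem_sdiff, mem_filter, mem_univ, true_and] at h1 h2
    rw [Bool.eq_iff_iff]
    tauto

lemma sum_overlap_le {m : ℕ} {σ : Fin (2 * m) → Bool} (hσ : σ ∈ labelings (2 * m) m)
    {φ : ℕ → ℝ} (hφ : ∀ j, 0 ≤ φ j) :
    ∑ τ ∈ labelings (2 * m) m, φ (overlap σ τ) ≤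
      ∑ j ∈ range (m + 1), (m.choose j : ℝ) ^ 2 * φ j := by
  rw [← sum_fiberwise_of_maps_to (s := labelings (2 * m) m) (t := range (m + 1))
    (g := fun τ => overlap σ τ)
    fun τ hτ => mem_range.2 (Nat.lt_succ_of_le (overlap_le σ hτ))]
  refine sum_le_sum fun j hj => ?_
  rw [sum_congr rfl fun τ hτ => congrArg φ (mem_filter.1 hτ).2, sum_const, nsmul_eq_mul]
  refine mul_le_mul_of_nonneg_right ?_ (hφ j)
  exact_mod_cast card_overlap_eq_le hσ (Nat.le_of_lt_succ (mem_range.1 hj))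

lemma Yn_eq {n k : ℕ} (hn : 0 < n) (G : Fin k → Fin n) :
    Yn n k G = (∑ σ ∈ labelings n (n / 2), pathWeight σ G) / n.choose (n / 2) := by
  have hn' : ((n : ℝ) ^ k) ≠ 0 := by positivity
  have h : ∀ σ : Fin n → Bool, Pcond n k σ G = ((n : ℝ) ^ k)⁻¹ * pathWeight σ G := fun σ => rfl
  simp only [Yn, h]
  rw [← mul_sum, ← mul_assoc, mul_inv_cancel₀ hn', one_mul]
  rfl

/-- The second moment of the likelihood ratio under the uniform law. -/
def secondMoment (n k : ℕ) : ℝ := ((n : ℝ) ^ k)⁻¹ * ∑ G : Fin k → Fin n, Yn n k G ^ 2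

lemma secondMoment_le {m : ℕ} (hm : 0 < m) (k : ℕ) :
    secondMoment (2 * m) k ≤
      (∑ j ∈ range (m + 1), (m.choose j : ℝ) ^ 2 *
        Real.exp (k * (((2 * j - m : ℝ) / m) ^ 2 / 3))) / (2 * m).choose m := by
  obtain ⟨C, hC⟩ : ∃ C : ℝ, C = (2 * m).choose m := ⟨_, rfl⟩
  have hCpos : 0 < C := by
    rw [hC]; exact_mod_cast Nat.choose_pos (by omega)
  obtain ⟨φ, hφ⟩ : ∃ φ : ℕ → ℝ, φ = fun j : ℕ =>
    Real.exp (k * (((2 * j - m : ℝ) / m) ^ 2 / 3)) := ⟨_, rfl⟩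
  have hN : (0 : ℝ) < ((2 * m : ℕ) : ℝ) ^ k := by positivity
  have hexp : ∑ G : Fin k → Fin (2 * m), Yn (2 * m) k G ^ 2 =
      (∑ σ ∈ labelings (2 * m) m, ∑ τ ∈ labelings (2 * m) m,
        ∑ G : Fin k → Fin (2 * m), pathWeight σ G * pathWeight τ G) / C ^ 2 := by
    simp only [Yn_eq (show 0 < 2 * m by omega), Nat.mul_div_cancel_left m two_pos, ← hC, div_pow]
    rw [← sum_div]
    congr 1
    simp only [sq, sum_mul_sum]
    rw [sum_comm]
    exact sum_congr rfl fun σ _ => sum_comm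
  have hpair : ∀ σ ∈ labelings (2 * m) m, ∀ τ ∈ labelings (2 * m) m,
      ∑ G : Fin k → Fin (2 * m), pathWeight σ G * pathWeight τ G ≤
        ((2 * m : ℕ) : ℝ) ^ k * φ (overlap σ τ) := fun σ hσ τ hτ => by
    rw [sum_pathWeight_mul (sum_spin hσ) (sum_spin hτ) (sum_spin_mul hm hσ hτ), hφ]
    exact mul_le_mul_of_nonneg_left (transferCoeff_fst_le _ _) hN.le
  have hφ0 : ∀ j, 0 ≤ φ j := fun j => by rw [hφ]; positivity
  obtain ⟨R, hR⟩ : ∃ R : ℝ, R = ∑ j ∈ range (m + 1), (m.choose j : ℝ) ^ 2 * φ j := ⟨_, rfl⟩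
  have hR0 : 0 ≤ R := by
    rw [hR]; exact sum_nonneg fun j _ => mul_nonneg (by positivity) (hφ0 j)
  have hsum : ∑ σ ∈ labelings (2 * m) m, ∑ τ ∈ labelings (2 * m) m,
      ∑ G : Fin k → Fin (2 * m), pathWeight σ G * pathWeight τ G ≤
        C * (((2 * m : ℕ) : ℝ) ^ k * R) := by
    calc _ ≤ ∑ σ ∈ labelings (2 * m) m, ((2 * m : ℕ) : ℝ) ^ k * R := by
          refine sum_le_sum fun σ hσ => (sum_le_sum (hpair σ hσ)).trans ?_
          rw [← mul_sum, hR]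
          exact mul_le_mul_of_nonneg_left (sum_overlap_le hσ hφ0) hN.le
      _ ≤ C * (((2 * m : ℕ) : ℝ) ^ k * R) := by
          rw [sum_const, nsmul_eq_mul, hC]
          refine mul_le_mul_of_nonneg_right ?_ (mul_nonneg hN.le hR0)
          exact_mod_cast card_labelings_le (2 * m) m
  have hgoal : secondMoment (2 * m) k ≤ R / C := by
    rw [secondMoment, hexp]
    calc _ ≤ (((2 * m : ℕ) : ℝ) ^ k)⁻¹ * (C * (((2 * m : ℕ) : ℝ) ^ k * R) / C ^ 2) := by gcongr
      _ = R / C := by field_simp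
  rw [hR, hC, hφ] at hgoal
  exact hgoal

lemma secondMoment_le_momentBound {c : ℝ} (hc0 : 0 ≤ c) {m : ℕ} (hm : 0 < m)
    (hβ : 0 < 1 / (m + 1 : ℝ) - 2 * c / 3 / m) :
    secondMoment (2 * m) (Nat.floor (c * (2 * m : ℕ))) ≤ momentBound (2 * c / 3) m := by
  refine (secondMoment_le hm _).trans ?_
  refine div_le_div_of_nonneg_right (le_trans ?_ (sum_choose_sq_mul_exp_le hβ)) (by positivity)
  refine sum_le_sum fun j _ => mul_le_mul_of_nonneg_left (Real.exp_le_exp.2 ?_) (by positivity)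
  have hm' : (m : ℝ) ≠ 0 := by exact_mod_cast hm.ne'
  refine (mul_le_mul_of_nonneg_right (Nat.floor_le (by positivity)) (by positivity)).trans_eq ?_
  push_cast
  field_simp


/-- for `0 ≤ c < 3/2` and `k = ⌊cn⌋`, the second moment of the likelihood ratio
`Y_n` under the uniform law satisfies `E[Y_n²] ≤ √(2/(2 − 4c/3)) + o(1)` as `n → ∞`. -/
theorem stmt19 (c : ℝ) (hc0 : 0 ≤ c) (hc : c < 3 / 2) :
    ∃ f : ℕ → ℝ, Tendsto f atTop (nhds 0) ∧
      ∀ n : ℕ, Even n → 0 < n →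
        ((n : ℝ) ^ Nat.floor (c * n))⁻¹ *
            ∑ G : Fin (Nat.floor (c * n)) → Fin n, Yn n (Nat.floor (c * n)) G ^ 2 ≤
          Real.sqrt (2 / (2 - 4 * c / 3)) + f n := by
  have hα : 2 * c / 3 < 1 := by linarith
  obtain ⟨L, hL⟩ : ∃ L : ℝ, L = √(2 / (2 - 4 * c / 3)) := ⟨_, rfl⟩
  have hL' : √(1 / (1 - 2 * c / 3)) = L := by
    rw [hL]
    congr 1
    rw [div_eq_div_iff (by linarith) (by linarith)]
    ring
  have hlim := tendsto_momentBound hα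
  rw [hL'] at hlim
  have hlim' : Tendsto (fun n : ℕ => max (momentBound (2 * c / 3) (n / 2) - L) 0) atTop
      (nhds 0) := by
    have h := (((hlim.comp (Nat.tendsto_div_const_atTop two_ne_zero)).sub_const L).max
      (tendsto_const_nhds (x := (0 : ℝ))))
    simpa using h
  refine ⟨fun n => if Even n then max (secondMoment n (Nat.floor (c * n)) - L) 0 else 0, ?_, ?_⟩
  · refine tendsto_of_tendsto_of_tendsto_of_le_of_le' tendsto_const_nhds hlim' ?_ ?_
    · refine Eventually.of_forall fun n => ?_
      split_ifs
      exacts [le_max_right _ _, le_rfl]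
    · have hpos := (tendsto_scaled_rate (2 * c / 3)).eventually_const_lt
        (show 0 < 1 - 2 * c / 3 by linarith)
      have hpos' := (Nat.tendsto_div_const_atTop two_ne_zero).eventually
        (hpos.and (eventually_gt_atTop 0))
      filter_upwards [hpos'] with n hn
      split_ifs with he
      · obtain ⟨m, rfl⟩ := he.two_dvd
        rw [Nat.mul_div_cancel_left m two_pos] at hn ⊢
        refine max_le_max_right 0 (sub_le_sub_right ?_ L)
        exact secondMoment_le_momentBound hc0 hn.2
          (pos_of_mul_pos_right hn.1 (Nat.cast_nonneg m))
      · exact le_max_right _ _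
  · intro n he _
    simp only [if_pos he]
    rw [← hL]
    have := le_max_left (secondMoment n (Nat.floor (c * n)) - L) 0
    rw [secondMoment] at this ⊢
    linarith
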